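/- arXiv:1801.09348 — 4 statements merged into one kernel-verified Lean document; each statement's English description precedes it below -/
import Mathlib

section
/- For every a > 0 there exists a constant C > 0 such that for all h ≥ 0, the series sum_{k=1}^∞ (1 - exp(-a (kπ)² h)) / (kπ)² converges and satisfies sum_{k=1}^∞ (1 - exp(-a (kπ)² h)) / (kπ)² ≤ C √h. -/
open Real

theorem one_sub_exp_neg_sq_le {t : ℝ} (ht : 0 ≤ t) :
    1 - Real.exp (-t ^ 2) ≤ 4 * t ^ 2 / (1 + t) ^ 2 := by
  have hpos : 0 < (1 + t) ^ 2 := by positivity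
  rw [le_div_iff₀ hpos]
  rcases le_total t 1 with h | h
  · have h1 : 1 - Real.exp (-t ^ 2) ≤ t ^ 2 := by linarith [Real.add_one_le_exp (-t ^ 2)]
    have h2 : (1 + t) ^ 2 ≤ 4 := by nlinarith
    nlinarith [mul_le_mul_of_nonneg_right h1 hpos.le, mul_le_mul_of_nonneg_left h2 (sq_nonneg t)]
  · have h1 : 1 - Real.exp (-t ^ 2) ≤ 1 := by linarith [Real.exp_pos (-t ^ 2)]
    nlinarith [mul_le_mul_of_nonneg_right h1 hpos.le]

theorem one_sub_exp_neg_sq_div_le {s m : ℝ} {k : ℕ} (hs : 0 ≤ s) (hm : (k : ℝ) + 1 ≤ m) :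
    (1 - Real.exp (-(s * m) ^ 2)) / m ^ 2 ≤
      4 * (s / (1 + s * (k : ℝ)) - s / (1 + s * ((k + 1 : ℕ) : ℝ))) := by
  have hk : (0 : ℝ) ≤ k := k.cast_nonneg
  have hm0 : 0 < m := by linarith
  have hk1 : 1 + s * k ≤ 1 + s * m := by
    gcongr
    linarith
  have hk2 : 1 + s * ((k : ℝ) + 1) ≤ 1 + s * m := by gcongr
  calc (1 - Real.exp (-(s * m) ^ 2)) / m ^ 2
      ≤ 4 * (s * m) ^ 2 / (1 + s * m) ^ 2 / m ^ 2 := by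
        gcongr
        exact one_sub_exp_neg_sq_le (by positivity)
    _ = 4 * s ^ 2 / ((1 + s * m) * (1 + s * m)) := by field_simp
    _ ≤ 4 * s ^ 2 / ((1 + s * k) * (1 + s * ((k : ℝ) + 1))) := by gcongr
    _ = 4 * (s / (1 + s * (k : ℝ)) - s / (1 + s * ((k + 1 : ℕ) : ℝ))) := by
        push_cast
        have h1 : 1 + s * (k : ℝ) ≠ 0 := by positivity
        have h2 : 1 + s * ((k : ℝ) + 1) ≠ 0 := by positivity
        field_simp
        ring

/-- For every `a > 0` there is `C > 0` such that for all `h ≥ 0`, the series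
`∑_{k=1}^∞ (1 - exp (-a (kπ)² h)) / (kπ)²` converges and is bounded by `C * √h`. -/
theorem integrated_heat_trace_bound (a : ℝ) (ha : 0 < a) :
    ∃ C : ℝ, 0 < C ∧ ∀ h : ℝ, 0 ≤ h →
      Summable (fun k : ℕ =>
        (1 - Real.exp (-a * (((k : ℝ) + 1) * π) ^ 2 * h)) / (((k : ℝ) + 1) * π) ^ 2) ∧
      (∑' k : ℕ,
        (1 - Real.exp (-a * (((k : ℝ) + 1) * π) ^ 2 * h)) / (((k : ℝ) + 1) * π) ^ 2)
        ≤ C * Real.sqrt h := by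
  refine ⟨4 * √a, by positivity, fun h hh => ?_⟩
  have hexp (k : ℕ) : -a * (((k : ℝ) + 1) * π) ^ 2 * h
      = -(√(a * h) * (((k : ℝ) + 1) * π)) ^ 2 := by
    rw [mul_pow √(a * h), Real.sq_sqrt (by positivity)]
    ring
  simp only [hexp]
  rw [mul_assoc, ← Real.sqrt_mul ha.le]
  have hs : 0 ≤ √(a * h) := Real.sqrt_nonneg _
  generalize √(a * h) = s at hs ⊢
  have hnonneg (k : ℕ) :
      0 ≤ (1 - Real.exp (-(s * (((k : ℝ) + 1) * π)) ^ 2)) / (((k : ℝ) + 1) * π) ^ 2 := by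
    refine div_nonneg (sub_nonneg.2 (Real.exp_le_one_iff.2 ?_)) (sq_nonneg _)
    exact neg_nonpos.2 (sq_nonneg _)
  have hsum (n : ℕ) : ∑ k ∈ Finset.range n,
      (1 - Real.exp (-(s * (((k : ℝ) + 1) * π)) ^ 2)) / (((k : ℝ) + 1) * π) ^ 2 ≤ 4 * s := by
    calc _ ≤ ∑ k ∈ Finset.range n,
          4 * (s / (1 + s * (k : ℝ)) - s / (1 + s * ((k + 1 : ℕ) : ℝ))) :=
          Finset.sum_le_sum fun k _ => one_sub_exp_neg_sq_div_le hs
            (le_mul_of_one_le_right (by positivity) (by linarith [Real.pi_gt_three]))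
      _ = 4 * (s - s / (1 + s * (n : ℝ))) := by
          rw [← Finset.mul_sum, Finset.sum_range_sub' (fun k : ℕ => s / (1 + s * (k : ℝ)))]
          simp
      _ ≤ 4 * s := by
          have : 0 ≤ s / (1 + s * (n : ℝ)) := by positivity
          linarith
  exact ⟨summable_of_sum_range_le hnonneg hsum, Real.tsum_le_of_sum_range_le hnonneg hsum⟩
end

section
/- For every integer N ≥ 1 and every t > 0, the tail series satisfies sum_{k=N+1}^∞ (1 - exp(-2 (kπ)² t)) / (2 (kπ)²) ≥ (t / (2 (1 + 2π² t))) · N^{-1}. -/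
open Real

theorem hasSum_inv_sub_inv_succ {a : ℝ} (ha : 0 < a) :
    HasSum (fun k : ℕ => (a + k)⁻¹ - (a + (k + 1 : ℕ))⁻¹) a⁻¹ := by
  rw [hasSum_iff_tendsto_nat_of_nonneg]
  · simp_rw [Finset.sum_range_sub' (fun k : ℕ => (a + (k : ℝ))⁻¹)]
    have h : Filter.Tendsto (fun n : ℕ => (a + (n : ℝ))⁻¹) Filter.atTop (nhds 0) :=
      tendsto_inv_atTop_zero.comp
        (Filter.tendsto_atTop_add_const_left _ a tendsto_natCast_atTop_atTop)
    simpa using h.const_sub a⁻¹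
  · intro k
    rw [sub_nonneg]
    gcongr
    simp

theorem div_one_add_le_one_sub_exp_neg {x : ℝ} (hx : 0 ≤ x) :
    x / (1 + x) ≤ 1 - Real.exp (-x) := by
  have h : Real.exp (-x) ≤ (1 + x)⁻¹ := by
    rw [Real.exp_neg]
    gcongr
    linarith [Real.add_one_le_exp x]
  have h' : x / (1 + x) = 1 - (1 + x)⁻¹ := by
    field_simp
    ring
  linarith

theorem inv_sub_inv_succ_le_term {m t : ℝ} (hm : 1 ≤ m) (ht : 0 < t) :
    t / (1 + 2 * π ^ 2 * t) * (m⁻¹ - (m + 1)⁻¹) ≤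
      (1 - Real.exp (-2 * (m * π) ^ 2 * t)) / (2 * (m * π) ^ 2) := by
  have hm0 : 0 < m := by linarith
  have hπ := Real.pi_pos
  have hx : 0 ≤ 2 * (m * π) ^ 2 * t := by positivity
  have hexp := div_one_add_le_one_sub_exp_neg hx
  calc t / (1 + 2 * π ^ 2 * t) * (m⁻¹ - (m + 1)⁻¹)
      = t / ((1 + 2 * π ^ 2 * t) * (m * (m + 1))) := by
        field_simp
        ring
    _ ≤ t / (1 + 2 * (m * π) ^ 2 * t) := by
        gcongr
        have : 0 < π ^ 2 * t := by positivity
        nlinarith [mul_pos this hm0]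
    _ = 2 * (m * π) ^ 2 * t / (1 + 2 * (m * π) ^ 2 * t) / (2 * (m * π) ^ 2) := by
        field_simp
    _ ≤ (1 - Real.exp (-(2 * (m * π) ^ 2 * t))) / (2 * (m * π) ^ 2) := by
        gcongr
    _ = _ := by ring_nf

theorem term_le_inv_sub_inv_succ {m t : ℝ} (hm : 1 ≤ m) :
    (1 - Real.exp (-2 * (m * π) ^ 2 * t)) / (2 * (m * π) ^ 2) ≤ m⁻¹ - (m + 1)⁻¹ := by
  have hm0 : 0 < m := by linarith
  have hπ := Real.pi_gt_three
  calc (1 - Real.exp (-2 * (m * π) ^ 2 * t)) / (2 * (m * π) ^ 2)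
      ≤ 1 / (2 * (m * π) ^ 2) := by
        gcongr
        linarith [Real.exp_pos (-2 * (m * π) ^ 2 * t)]
    _ ≤ 1 / (m * (m + 1)) := by
        refine one_div_le_one_div_of_le (by positivity) ?_
        have : 1 ≤ π ^ 2 := by nlinarith
        nlinarith [mul_le_mul_of_nonneg_left this (sq_nonneg m)]
    _ = m⁻¹ - (m + 1)⁻¹ := by
        field_simp
        ring

/-- For every integer `N ≥ 1` and every `t > 0`, the tail series satisfies
`∑_{k=N+1}^∞ (1 - exp (-2 (kπ)² t)) / (2 (kπ)²) ≥ (t / (2 (1 + 2π² t))) * N⁻¹`. -/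
theorem galerkin_ou_error_lower (N : ℕ) (hN : 1 ≤ N) (t : ℝ) (ht : 0 < t) :
    (∑' k : ℕ,
        (1 - Real.exp (-2 * (((N : ℝ) + (k : ℝ) + 1) * π) ^ 2 * t)) /
          (2 * (((N : ℝ) + (k : ℝ) + 1) * π) ^ 2))
      ≥ (t / (2 * (1 + 2 * π ^ 2 * t))) * (N : ℝ)⁻¹ := by
  have hN' : (1 : ℝ) ≤ N := by exact_mod_cast hN
  have hm (k : ℕ) : (1 : ℝ) ≤ (N : ℝ) + k + 1 := by
    have := k.cast_nonneg (α := ℝ)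
    linarith
  have htel : HasSum (fun k : ℕ => ((N : ℝ) + k + 1)⁻¹ - ((N : ℝ) + k + 1 + 1)⁻¹)
      ((N : ℝ) + 1)⁻¹ := by
    convert hasSum_inv_sub_inv_succ (show (0 : ℝ) < N + 1 by positivity) using 4 <;>
      push_cast <;> ring
  have hlow (k : ℕ) := inv_sub_inv_succ_le_term (hm k) ht
  have hsum : Summable fun k : ℕ =>
      (1 - Real.exp (-2 * (((N : ℝ) + (k : ℝ) + 1) * π) ^ 2 * t)) /
        (2 * (((N : ℝ) + (k : ℝ) + 1) * π) ^ 2) := by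
    refine Summable.of_nonneg_of_le (fun k => ?_)
      (fun k => term_le_inv_sub_inv_succ (hm k)) htel.summable
    have hexp : Real.exp (-2 * (((N : ℝ) + (k : ℝ) + 1) * π) ^ 2 * t) ≤ 1 := by
      rw [Real.exp_le_one_iff]
      have : 0 ≤ (((N : ℝ) + (k : ℝ) + 1) * π) ^ 2 * t := by positivity
      linarith
    exact div_nonneg (by linarith) (by positivity)
  calc t / (2 * (1 + 2 * π ^ 2 * t)) * (N : ℝ)⁻¹
      = t / (1 + 2 * π ^ 2 * t) * (2 * (N : ℝ))⁻¹ := by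
        field_simp
    _ ≤ t / (1 + 2 * π ^ 2 * t) * ((N : ℝ) + 1)⁻¹ := by
        gcongr
        linarith
    _ ≤ _ := hasSum_le hlow (htel.mul_left _) hsum.hasSum
end

section
/- There exists a constant C > 0 such that for all real numbers s, t with 0 ≤ s ≤ t, one has sum_{k=1}^∞ (1 - exp(-2 (kπ)² (t−s))) / (2 (kπ)²) + sum_{k=1}^∞ ((1 - exp(-2 (kπ)² s)) / (2 (kπ)²)) · (1 - exp(-(kπ)² (t−s)))² ≤ C √(t−s). -/
open Real

/-- The sequence `4r² / ((1 + kr)(1 + (k+1)r))` telescopes and dominates `min (r², 1/(k+1)²)`. -/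
lemma le_telescope_of_le_sq {r g : ℝ} (k : ℕ) (hr : 0 ≤ r) (hg : 0 ≤ g) (h₁ : g ≤ r ^ 2)
    (h₂ : g * ((k : ℝ) + 1) ^ 2 ≤ 1) :
    g ≤ 4 * r * (1 / (1 + k * r)) - 4 * r * (1 / (1 + ((k + 1 : ℕ) : ℝ) * r)) := by
  have hk : (0 : ℝ) ≤ k := k.cast_nonneg
  have hgn : g * ((k : ℝ) + 1) ≤ r := by
    refine abs_le_of_sq_le_sq' ?_ hr |>.2
    calc (g * ((k : ℝ) + 1)) ^ 2 = g * (g * ((k : ℝ) + 1) ^ 2) := by ring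
      _ ≤ g * 1 := by gcongr
      _ ≤ r ^ 2 := by linarith
  have hsq : g * (1 + ((k : ℝ) + 1) * r) ^ 2 ≤ 4 * r ^ 2 := by
    have e₁ : g * ((k : ℝ) + 1) * r ≤ r * r := by gcongr
    have e₂ : g * ((k : ℝ) + 1) ^ 2 * r ^ 2 ≤ 1 * r ^ 2 := by gcongr
    nlinarith
  have p₁ : 0 < 1 + (k : ℝ) * r := by positivity
  have p₂ : 0 < 1 + ((k : ℝ) + 1) * r := by positivity
  have htel : 4 * r * (1 / (1 + k * r)) - 4 * r * (1 / (1 + ((k + 1 : ℕ) : ℝ) * r)) =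
      4 * r ^ 2 / ((1 + k * r) * (1 + ((k : ℝ) + 1) * r)) := by
    push_cast
    field_simp
    ring
  rw [htel, le_div_iff₀ (by positivity)]
  refine le_trans ?_ hsq
  rw [sq (1 + ((k : ℝ) + 1) * r)]
  gcongr
  linarith

lemma tsum_le_four_mul_of_le_sq {r : ℝ} {f : ℕ → ℝ} (hr : 0 ≤ r) (hf : ∀ k, 0 ≤ f k)
    (h₁ : ∀ k, f k ≤ r ^ 2) (h₂ : ∀ k, f k * ((k : ℝ) + 1) ^ 2 ≤ 1) :
    ∑' k, f k ≤ 4 * r := by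
  refine Real.tsum_le_of_sum_range_le hf fun n => ?_
  calc ∑ k ∈ Finset.range n, f k
      ≤ ∑ k ∈ Finset.range n,
          (4 * r * (1 / (1 + (k : ℝ) * r)) - 4 * r * (1 / (1 + ((k + 1 : ℕ) : ℝ) * r))) :=
        Finset.sum_le_sum fun k _ => le_telescope_of_le_sq k hr (hf k) (h₁ k) (h₂ k)
    _ = 4 * r * (1 / (1 + ((0 : ℕ) : ℝ) * r)) - 4 * r * (1 / (1 + (n : ℝ) * r)) :=
        Finset.sum_range_sub' (fun k : ℕ => 4 * r * (1 / (1 + (k : ℝ) * r))) n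
    _ ≤ 4 * r := by
        have : 0 ≤ 4 * r * (1 / (1 + (n : ℝ) * r)) := by positivity
        simpa using this

lemma one_sub_exp_div_nonneg {a τ : ℝ} (ha : 0 < a) (hτ : 0 ≤ τ) :
    0 ≤ (1 - exp (-2 * a * τ)) / (2 * a) := by
  have : exp (-2 * a * τ) ≤ 1 := exp_le_one_iff.2 (by nlinarith [mul_nonneg ha.le hτ])
  exact div_nonneg (by linarith) (by positivity)

lemma one_sub_exp_div_le {a τ : ℝ} (ha : 0 < a) : (1 - exp (-2 * a * τ)) / (2 * a) ≤ τ := by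
  rw [div_le_iff₀ (by positivity)]
  linarith [add_one_le_exp (-2 * a * τ)]

lemma one_sub_exp_div_mul_le_one {a τ b : ℝ} (ha : 0 < a) (hb : 0 ≤ b) (hba : b ≤ a) :
    (1 - exp (-2 * a * τ)) / (2 * a) * b ≤ 1 := by
  rw [div_mul_eq_mul_div, div_le_one (by positivity)]
  nlinarith [mul_nonneg (exp_pos (-2 * a * τ)).le hb]

lemma one_sub_exp_div_mul_sq_le {a s τ : ℝ} (ha : 0 < a) (hτ : 0 ≤ τ) :
    (1 - exp (-2 * a * s)) / (2 * a) * (1 - exp (-a * τ)) ^ 2 ≤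
      (1 - exp (-2 * a * τ)) / (2 * a) := by
  have hx : exp (-2 * a * τ) = exp (-a * τ) ^ 2 := by
    rw [← exp_nat_mul]; congr 1; push_cast; ring
  have h₁ : exp (-a * τ) ≤ 1 := exp_le_one_iff.2 (by nlinarith [mul_nonneg ha.le hτ])
  have h₀ := (exp_pos (-a * τ)).le
  rw [div_mul_eq_mul_div]
  gcongr
  rw [hx]
  nlinarith [mul_nonneg (exp_pos (-2 * a * s)).le (sq_nonneg (1 - exp (-a * τ))),
    mul_nonneg h₀ (sub_nonneg.2 h₁)]


/-- There is `C > 0` such that for all `0 ≤ s ≤ t`: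
`∑_{k=1}^∞ (1 - exp (-2(kπ)²(t-s))) / (2(kπ)²)
  + ∑_{k=1}^∞ ((1 - exp (-2(kπ)²s)) / (2(kπ)²)) (1 - exp (-(kπ)²(t-s)))² ≤ C √(t-s)`. -/
theorem ou_increment_bound :
    ∃ C : ℝ, 0 < C ∧ ∀ s t : ℝ, 0 ≤ s → s ≤ t →
      (∑' k : ℕ,
          (1 - Real.exp (-2 * (((k : ℝ) + 1) * π) ^ 2 * (t - s))) /
            (2 * (((k : ℝ) + 1) * π) ^ 2))
        + (∑' k : ℕ,
            ((1 - Real.exp (-2 * (((k : ℝ) + 1) * π) ^ 2 * s)) /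
                (2 * (((k : ℝ) + 1) * π) ^ 2)) *
              (1 - Real.exp (-(((k : ℝ) + 1) * π) ^ 2 * (t - s))) ^ 2)
        ≤ C * Real.sqrt (t - s) := by
  refine ⟨8, by norm_num, fun s t hs hst => ?_⟩
  have hτ : 0 ≤ t - s := sub_nonneg.2 hst
  have hr : √(t - s) ^ 2 = t - s := sq_sqrt hτ
  have ha (k : ℕ) : 0 < (((k : ℝ) + 1) * π) ^ 2 := by positivity
  have hba (k : ℕ) : ((k : ℝ) + 1) ^ 2 ≤ (((k : ℝ) + 1) * π) ^ 2 := by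
    gcongr
    exact le_mul_of_one_le_right (by positivity) (by linarith [pi_gt_three])
  have hfirst := tsum_le_four_mul_of_le_sq (sqrt_nonneg (t - s))
    (fun k => one_sub_exp_div_nonneg (ha k) hτ)
    (fun k => (one_sub_exp_div_le (ha k)).trans hr.ge)
    (fun k => one_sub_exp_div_mul_le_one (τ := t - s) (ha k) (by positivity) (hba k))
  have hsecond := tsum_le_four_mul_of_le_sq (sqrt_nonneg (t - s))
    (fun k => mul_nonneg (one_sub_exp_div_nonneg (ha k) hs)
      (sq_nonneg (1 - exp (-(((k : ℝ) + 1) * π) ^ 2 * (t - s)))))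
    (fun k => ((one_sub_exp_div_mul_sq_le (ha k) hτ).trans (one_sub_exp_div_le (ha k))).trans hr.ge)
    (fun k => (mul_le_mul_of_nonneg_right (one_sub_exp_div_mul_sq_le (ha k) hτ)
      (by positivity)).trans (one_sub_exp_div_mul_le_one (ha k) (by positivity) (hba k)))
  linarith
end

section
/- Let T > 0, G ≥ 0, and let g : [0,T] → ℓ²(ℕ₊) be a measurable function with ‖g(r)‖_{ℓ²} ≤ G for all r ∈ [0,T]. Define z : [0,T] → ℓ²(ℕ₊) componentwise by z_k(t) = ∫_0^t exp(-(kπ)² (t−r)) g_k(r) dr. Then there exists an absolute constant C > 0 (independent of T, G, g) such that for all 0 ≤ s ≤ t ≤ T, sum_{k=1}^∞ (kπ)² |z_k(t) − z_k(s)|² ≤ C G² (t − s). -/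
open Real MeasureTheory

lemma intervalIntegrable_of_measurable_of_bounded {f : ℝ → ℝ} {a b M : ℝ} (hab : a ≤ b)
    (hf : Measurable f) (hM : ∀ r ∈ Set.Icc a b, |f r| ≤ M) :
    IntervalIntegrable f volume a b := by
  rw [intervalIntegrable_iff_integrableOn_Icc_of_le hab]
  refine Measure.integrableOn_of_bounded (M := M) measure_Icc_lt_top.ne
    hf.aestronglyMeasurable ?_
  filter_upwards [ae_restrict_mem measurableSet_Icc] with r hr using hM r hr

lemma integral_exp_neg_mul_sub {c : ℝ} (hc : 0 < c) (a b : ℝ) :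
    ∫ r in a..b, exp (-c * (b - r)) = (1 - exp (-c * (b - a))) / c := by
  have key : ∀ r ∈ Set.uIcc a b,
      HasDerivAt (fun r => exp (-c * (b - r)) / c) (exp (-c * (b - r))) r := by
    intro r _
    have h := ((((hasDerivAt_id' r).const_sub b).const_mul (-c)).exp).div_const c
    exact h.congr_deriv (by field_simp)
  rw [intervalIntegral.integral_eq_sub_of_hasDerivAt key
    (Continuous.intervalIntegrable (by fun_prop) _ _)]
  simp [sub_div]

/-- Cauchy–Schwarz with respect to the exponential weight, whose mass is at most `1 / c`. -/
lemma mul_sq_integral_exp_mul_le {f : ℝ → ℝ} {a b c : ℝ} (hc : 0 < c) (hab : a ≤ b)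
    (hf : IntervalIntegrable f volume a b)
    (hf2 : IntervalIntegrable (fun r => f r ^ 2) volume a b) :
    c * (∫ r in a..b, exp (-c * (b - r)) * f r) ^ 2 ≤
      ∫ r in a..b, exp (-c * (b - r)) * f r ^ 2 := by
  have hw : Continuous fun r => exp (-c * (b - r)) := by fun_prop
  have i1 := hf.continuousOn_mul hw.continuousOn
  have i2 := hf2.continuousOn_mul hw.continuousOn
  have i0 := hw.intervalIntegrable (μ := volume) a b
  generalize hI : ∫ r in a..b, exp (-c * (b - r)) * f r = I
  have h0 : 0 ≤ ∫ r in a..b, exp (-c * (b - r)) * (f r - c * I) ^ 2 :=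
    intervalIntegral.integral_nonneg hab fun r _ => by positivity
  have h1 : ∫ r in a..b, exp (-c * (b - r)) * (f r - c * I) ^ 2 =
      (∫ r in a..b, exp (-c * (b - r)) * f r ^ 2) -
        2 * c * I * (∫ r in a..b, exp (-c * (b - r)) * f r) +
        (c * I) ^ 2 * ∫ r in a..b, exp (-c * (b - r)) := by
    rw [← intervalIntegral.integral_const_mul, ← intervalIntegral.integral_const_mul,
      ← intervalIntegral.integral_sub i2 (i1.const_mul _),
      ← intervalIntegral.integral_add (i2.sub (i1.const_mul _)) (i0.const_mul _)]
    congr 1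
    ext r
    ring
  have h2 : (c * I) ^ 2 * ∫ r in a..b, exp (-c * (b - r)) ≤ c * I ^ 2 := by
    rw [integral_exp_neg_mul_sub hc]
    have : (c * I) ^ 2 * ((1 - exp (-c * (b - a))) / c) =
        c * I ^ 2 - c * I ^ 2 * exp (-c * (b - a)) := by
      field_simp
    have : 0 ≤ c * I ^ 2 * exp (-c * (b - a)) := by positivity
    linarith
  rw [h1, hI] at h0
  linarith

lemma sq_one_sub_exp_mul_exp_le {c h τ : ℝ} (hc : 0 < c) (hh : 0 < h) (hτ : 0 ≤ τ) :
    (1 - exp (-c * h)) ^ 2 * exp (-c * τ) ≤ 6 * (h ^ 2 / (h + τ) ^ 2) := by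
  have e1 : exp (-c * h) ≤ 1 := exp_le_one_iff.2 (by nlinarith)
  have e2 : 1 - exp (-c * h) ≤ c * h := by linarith [add_one_le_exp (-c * h)]
  have e0 := exp_pos (-c * h)
  have e3 : exp (-c * τ) ≤ 1 := exp_le_one_iff.2 (by nlinarith)
  have e4 : (c * τ) ^ 2 * exp (-c * τ) ≤ 2 := by
    have hx : 0 ≤ c * τ := by positivity
    have := quadratic_le_exp_of_nonneg hx
    rw [neg_mul, exp_neg, ← div_eq_mul_inv, div_le_iff₀ (exp_pos _)]
    linarith
  have p0 := exp_pos (-c * τ)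
  have q1 : (1 - exp (-c * h)) ^ 2 ≤ 1 := by nlinarith
  have q2 : (1 - exp (-c * h)) ^ 2 ≤ (c * h) ^ 2 := by gcongr
  have r1 : (1 - exp (-c * h)) ^ 2 * exp (-c * τ) ≤ 1 := mul_le_one₀ q1 p0.le e3
  have r2 : τ ^ 2 * ((1 - exp (-c * h)) ^ 2 * exp (-c * τ)) ≤ 2 * h ^ 2 :=
    calc τ ^ 2 * ((1 - exp (-c * h)) ^ 2 * exp (-c * τ))
        ≤ τ ^ 2 * ((c * h) ^ 2 * exp (-c * τ)) := by gcongr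
      _ = ((c * τ) ^ 2 * exp (-c * τ)) * h ^ 2 := by ring
      _ ≤ 2 * h ^ 2 := by gcongr
  rw [← mul_div_assoc, le_div_iff₀ (by positivity)]
  set A := (1 - exp (-c * h)) ^ 2 * exp (-c * τ)
  have hA : 0 ≤ A := by positivity
  nlinarith [mul_nonneg hA (sq_nonneg (h - τ)), mul_le_mul_of_nonneg_right r1 (sq_nonneg h)]

lemma continuousOn_sq_div_add_sub_sq {h s : ℝ} (hh : 0 < h) (hs : 0 ≤ s) :
    ContinuousOn (fun r => h ^ 2 / (h + (s - r)) ^ 2) (Set.uIcc 0 s) := by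
  refine ContinuousOn.div (by fun_prop) (by fun_prop) fun r hr => ?_
  rw [Set.uIcc_of_le hs] at hr
  have : 0 < h + (s - r) := by linarith [hr.2]
  positivity

lemma integral_sq_div_add_sub_sq_le {h s : ℝ} (hh : 0 < h) (hs : 0 ≤ s) :
    ∫ r in (0 : ℝ)..s, h ^ 2 / (h + (s - r)) ^ 2 ≤ h := by
  have key : ∀ r ∈ Set.uIcc 0 s,
      HasDerivAt (fun r => h ^ 2 / (h + (s - r))) (h ^ 2 / (h + (s - r)) ^ 2) r := by
    intro r hr
    rw [Set.uIcc_of_le hs] at hr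
    have hp : h + (s - r) ≠ 0 := by linarith [hr.2]
    have hd := (hasDerivAt_const r (h ^ 2)).div (((hasDerivAt_id' r).const_sub s).const_add h) hp
    exact hd.congr_deriv (by ring)
  rw [intervalIntegral.integral_eq_sub_of_hasDerivAt key
    (continuousOn_sq_div_add_sub_sq hh hs).intervalIntegrable]
  have : 0 ≤ h ^ 2 / (h + (s - 0)) := by positivity
  have h2 : h ^ 2 / (h + (s - s)) = h := by field_simp; ring
  linarith

/-- Increment bound for one mode of the heat convolution, with constants uniform in the decay
rate `c`. -/
lemma mul_sq_convolution_sub_le {f : ℝ → ℝ} {c s t M : ℝ} (hc : 0 < c) (hs : 0 ≤ s) (hst : s < t)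
    (hf : Measurable f) (hM : ∀ r ∈ Set.Icc 0 t, |f r| ≤ M) :
    c * ((∫ r in (0 : ℝ)..t, exp (-c * (t - r)) * f r) -
        ∫ r in (0 : ℝ)..s, exp (-c * (s - r)) * f r) ^ 2 ≤
      2 * (∫ r in s..t, f r ^ 2) +
        12 * ∫ r in (0 : ℝ)..s, (t - s) ^ 2 / (t - s + (s - r)) ^ 2 * f r ^ 2 := by
  have hM2 : ∀ r ∈ Set.Icc 0 t, |f r ^ 2| ≤ M ^ 2 := fun r hr => by
    rw [abs_pow]; exact pow_le_pow_left₀ (abs_nonneg _) (hM r hr) 2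
  have sub1 : Set.Icc 0 s ⊆ Set.Icc 0 t := Set.Icc_subset_Icc_right hst.le
  have sub2 : Set.Icc s t ⊆ Set.Icc 0 t := Set.Icc_subset_Icc_left hs
  have f1 := intervalIntegrable_of_measurable_of_bounded hs hf fun r hr => hM r (sub1 hr)
  have f2 := intervalIntegrable_of_measurable_of_bounded hst.le hf fun r hr => hM r (sub2 hr)
  have g1 := intervalIntegrable_of_measurable_of_bounded hs (hf.pow_const 2)
    fun r hr => hM2 r (sub1 hr)
  have g2 := intervalIntegrable_of_measurable_of_bounded hst.le (hf.pow_const 2)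
    fun r hr => hM2 r (sub2 hr)
  have hw : ∀ u, Continuous fun r => exp (-c * (u - r)) := fun u => by fun_prop
  have split : (∫ r in (0 : ℝ)..t, exp (-c * (t - r)) * f r) -
      (∫ r in (0 : ℝ)..s, exp (-c * (s - r)) * f r) =
      (∫ r in s..t, exp (-c * (t - r)) * f r) -
        (1 - exp (-c * (t - s))) * ∫ r in (0 : ℝ)..s, exp (-c * (s - r)) * f r := by
    rw [← intervalIntegral.integral_add_adjacent_intervals
      (f1.continuousOn_mul (hw t).continuousOn) (f2.continuousOn_mul (hw t).continuousOn)]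
    have : ∫ r in (0 : ℝ)..s, exp (-c * (t - r)) * f r =
        exp (-c * (t - s)) * ∫ r in (0 : ℝ)..s, exp (-c * (s - r)) * f r := by
      rw [← intervalIntegral.integral_const_mul]
      congr 1
      ext r
      rw [← mul_assoc, ← exp_add]
      ring_nf
    rw [this]
    ring
  have b1 : c * (∫ r in s..t, exp (-c * (t - r)) * f r) ^ 2 ≤ ∫ r in s..t, f r ^ 2 := by
    refine (mul_sq_integral_exp_mul_le hc hst.le f2 g2).trans ?_
    refine intervalIntegral.integral_mono_on hst.le
      (g2.continuousOn_mul (hw t).continuousOn) g2 fun r hr => ?_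
    exact mul_le_of_le_one_left (sq_nonneg _) (exp_le_one_iff.2 (by nlinarith [hr.2]))
  have b2 : c * ((1 - exp (-c * (t - s))) *
      ∫ r in (0 : ℝ)..s, exp (-c * (s - r)) * f r) ^ 2 ≤
      6 * ∫ r in (0 : ℝ)..s, (t - s) ^ 2 / (t - s + (s - r)) ^ 2 * f r ^ 2 := by
    calc _ = (1 - exp (-c * (t - s))) ^ 2 *
          (c * (∫ r in (0 : ℝ)..s, exp (-c * (s - r)) * f r) ^ 2) := by ring
      _ ≤ (1 - exp (-c * (t - s))) ^ 2 * ∫ r in (0 : ℝ)..s, exp (-c * (s - r)) * f r ^ 2 := by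
          gcongr
          exact mul_sq_integral_exp_mul_le hc hs f1 g1
      _ ≤ _ := by
          rw [← intervalIntegral.integral_const_mul, ← intervalIntegral.integral_const_mul]
          refine intervalIntegral.integral_mono_on hs
            ((g1.continuousOn_mul (hw s).continuousOn).const_mul _)
            ((g1.continuousOn_mul
              (continuousOn_sq_div_add_sub_sq (sub_pos.2 hst) hs)).const_mul _) fun r hr => ?_
          rw [← mul_assoc, ← mul_assoc]
          exact mul_le_mul_of_nonneg_right
            (sq_one_sub_exp_mul_exp_le hc (sub_pos.2 hst) (sub_nonneg.2 hr.2)) (sq_nonneg _)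
  rw [split]
  set A := ∫ r in s..t, exp (-c * (t - r)) * f r
  set B := (1 - exp (-c * (t - s))) * ∫ r in (0 : ℝ)..s, exp (-c * (s - r)) * f r
  nlinarith [mul_nonneg hc.le (sq_nonneg (A + B))]

lemma sum_integral_mul_sq_le {g : ℝ → ℕ → ℝ} {w : ℝ → ℝ} {a b G : ℝ} (hab : a ≤ b)
    (hg : ∀ k, Measurable fun r => g r k)
    (hsum : ∀ F : Finset ℕ, ∀ r ∈ Set.Icc a b, ∑ k ∈ F, g r k ^ 2 ≤ G ^ 2)
    (hw : ContinuousOn w (Set.uIcc a b)) (hw0 : ∀ r ∈ Set.Icc a b, 0 ≤ w r) (F : Finset ℕ) :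
    ∑ k ∈ F, ∫ r in a..b, w r * g r k ^ 2 ≤ (∫ r in a..b, w r) * G ^ 2 := by
  have hi : ∀ k, IntervalIntegrable (fun r => w r * g r k ^ 2) volume a b := fun k =>
    (intervalIntegrable_of_measurable_of_bounded (M := G ^ 2) hab ((hg k).pow_const 2)
      fun r hr => by simpa using hsum {k} r hr).continuousOn_mul hw
  rw [← intervalIntegral.integral_finsetSum fun k _ => hi k,
    ← intervalIntegral.integral_mul_const]
  refine intervalIntegral.integral_mono_on hab ?_ (hw.intervalIntegrable.mul_const _)
    fun r hr => ?_
  · simpa [Finset.sum_fn] using IntervalIntegrable.sum F fun k _ => hi k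
  · rw [← Finset.mul_sum]
    exact mul_le_mul_of_nonneg_left (hsum F r hr) (hw0 r hr)

/-- 1/2-Hölder continuity of the heat convolution into `Ḣ¹`: there is an absolute
constant `C > 0` such that whenever `T > 0`, `G ≥ 0`, and `g : [0,T] → ℓ²` is
measurable with `‖g(r)‖_{ℓ²} ≤ G` on `[0,T]` (here `g r k` stands for the `(k+1)`-st
component `g_{k+1}(r)`), the function `z` with components
`z_k(t) = ∫_0^t exp(-(kπ)²(t-r)) g_k(r) dr` satisfies
`∑_{k≥1} (kπ)² |z_k(t) - z_k(s)|² ≤ C G² (t - s)` for all `0 ≤ s ≤ t ≤ T`. -/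
theorem heat_convolution_holder_H1 :
    ∃ C : ℝ, 0 < C ∧
      ∀ (T G : ℝ), 0 < T → 0 ≤ G →
      ∀ g : ℝ → ℕ → ℝ,
        (∀ k : ℕ, Measurable fun r => g r k) →
        (∀ r ∈ Set.Icc (0 : ℝ) T,
          Summable (fun k : ℕ => (g r k) ^ 2) ∧
            Real.sqrt (∑' k : ℕ, (g r k) ^ 2) ≤ G) →
        ∀ s t : ℝ, 0 ≤ s → s ≤ t → t ≤ T →
          (∑' k : ℕ,
              (((k : ℝ) + 1) * π) ^ 2 *
                ((∫ r in (0 : ℝ)..t,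
                    Real.exp (-(((k : ℝ) + 1) * π) ^ 2 * (t - r)) * g r k) -
                  (∫ r in (0 : ℝ)..s,
                    Real.exp (-(((k : ℝ) + 1) * π) ^ 2 * (s - r)) * g r k)) ^ 2)
            ≤ C * G ^ 2 * (t - s) := by
  refine ⟨14, by norm_num, fun T G _ hG g hg hbd s t hs hst htT => ?_⟩
  rcases hst.eq_or_lt with rfl | hlt
  · simp
  have hsum : ∀ F : Finset ℕ, ∀ r ∈ Set.Icc (0 : ℝ) t, ∑ k ∈ F, g r k ^ 2 ≤ G ^ 2 := by
    intro F r hr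
    obtain ⟨h1, h2⟩ := hbd r ⟨hr.1, hr.2.trans htT⟩
    exact (h1.sum_le_tsum F fun k _ => sq_nonneg _).trans ((sqrt_le_left hG).1 h2)
  have habs : ∀ k, ∀ r ∈ Set.Icc (0 : ℝ) t, |g r k| ≤ G := fun k r hr =>
    abs_le_of_sq_le_sq (by simpa using hsum {k} r hr) hG
  have h1 := sum_integral_mul_sq_le (w := fun _ => 1) hst hg
    (fun F r hr => hsum F r ⟨hs.trans hr.1, hr.2⟩) continuousOn_const fun _ _ => zero_le_one
  have h2 := sum_integral_mul_sq_le hs hg (fun F r hr => hsum F r ⟨hr.1, hr.2.trans hst⟩)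
    (continuousOn_sq_div_add_sub_sq (sub_pos.2 hlt) hs) fun r _ => by positivity
  have h3 := mul_le_mul_of_nonneg_right
    (integral_sq_div_add_sub_sq_le (sub_pos.2 hlt) hs) (sq_nonneg G)
  refine Real.tsum_le_of_sum_le (fun k => by positivity) fun F => ?_
  refine (Finset.sum_le_sum fun (k : ℕ) _ => mul_sq_convolution_sub_le
    (show 0 < (((k : ℝ) + 1) * π) ^ 2 by positivity) hs hlt (hg k) (habs k)).trans ?_
  rw [Finset.sum_add_distrib, ← Finset.mul_sum, ← Finset.mul_sum]
  have h1F := h1 F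
  simp only [one_mul, intervalIntegral.integral_const, smul_eq_mul, mul_one] at h1F
  linarith [h2 F]
end
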